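/- For every simple digraph G = (V,E) and n ≥ 0, the module Π_n(G) decomposes as direct sums Π_n(G) = ⊕_{a∈V} Π_n^{[a,·]}(G) = ⊕_{b∈V} Π_n^{[·,b]}(G) = ⊕_{a,b∈V} Π_n^{[a,b]}(G), where the summands are generated respectively by a-tail, b-head, and (a,b)-cluster paths in Π_n(G). Moreover Π_n^{[a,b]}(G) = Π_n^{[a,·]}(G) ∩ Π_n^{[·,b]}(G). -/

import Mathlib

noncomputable section

namespace PrimitivePath

/-- A simple digraph: arrows between distinct vertices. -/
structure SDigraph (V : Type) where
  Adj : V → V → Prop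
  loopless : ∀ v, ¬ Adj v v

section

variable (R V : Type) [CommRing R] [DecidableEq V]

/-- `Chain R V n` is the free `R`-module `Λ_n(V,R)` on elementary `n`-paths
(sequences of `n+1` vertices). -/
abbrev Chain (n : ℕ) : Type _ := (Fin (n + 1) → V) →₀ R

/-- An elementary path is allowed if consecutive vertices are joined by arrows. -/
def IsAllowed {V : Type} (G : SDigraph V) {n : ℕ} (p : Fin (n + 1) → V) : Prop :=
  ∀ i : Fin n, G.Adj (p i.castSucc) (p i.succ)

/-- An elementary path is regular if it has no two equal consecutive vertices. -/
def IsRegular {V : Type} {n : ℕ} (p : Fin (n + 1) → V) : Prop :=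
  ∀ i : Fin n, p i.castSucc ≠ p i.succ

instance {n : ℕ} (p : Fin (n + 1) → V) : Decidable (IsRegular p) :=
  inferInstanceAs (Decidable (∀ i : Fin n, p i.castSucc ≠ p i.succ))

/-- The differential `∂ : Λ_{n+1} → Λ_n`, alternating sum of vertex deletions. -/
def boundary (n : ℕ) : Chain R V (n + 1) →ₗ[R] Chain R V n :=
  Finsupp.lsum R fun p => ∑ m : Fin (n + 2),
    ((-1 : R) ^ (m : ℕ)) • Finsupp.lsingle (fun i : Fin (n + 1) => p (m.succAbove i))

/-- The `m`-th face map `∂^m : Λ_{n+1} → Λ_n`, deleting the `m`-th vertex. -/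
def faceMap (n : ℕ) (m : Fin (n + 2)) : Chain R V (n + 1) →ₗ[R] Chain R V n :=
  Finsupp.lsum R fun p => Finsupp.lsingle (fun i : Fin (n + 1) => p (m.succAbove i))

/-- The submodule of chains all of whose elementary paths satisfy `P`. -/
def pathsWith {n : ℕ} (P : (Fin (n + 1) → V) → Prop) : Submodule R (Chain R V n) where
  carrier := {w | ∀ p ∈ w.support, P p}
  add_mem' := by
    intro x y hx hy p hp
    rcases Finset.mem_union.1 (Finsupp.support_add hp) with h | h
    · exact hx p h
    · exact hy p h
  zero_mem' := by intro p hp; simp at hp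
  smul_mem' := by intro c x hx p hp; exact hx p (Finsupp.support_smul hp)

/-- `A_n(G)`: the submodule of allowed chains. -/
def allowedChains (G : SDigraph V) (n : ℕ) : Submodule R (Chain R V n) :=
  pathsWith R V (fun p => IsAllowed G p)

/-- Chains all of whose elementary paths have tail vertex `a`. -/
def tailSet (a : V) (n : ℕ) : Submodule R (Chain R V n) :=
  pathsWith R V (fun p => p 0 = a)

/-- Chains all of whose elementary paths have head vertex `b`. -/
def headSet (b : V) (n : ℕ) : Submodule R (Chain R V n) :=
  pathsWith R V (fun p => p (Fin.last n) = b)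

/-- Chains all of whose elementary paths have tail `a` and head `b`
(the `(a,b)`-cluster module `Λ_n^{[a,b]}`). -/
def clusterSet (a b : V) (n : ℕ) : Submodule R (Chain R V n) :=
  pathsWith R V (fun p => p 0 = a ∧ p (Fin.last n) = b)

/-- Projection killing the irregular elementary paths, modelling `Λ_n → R_n = Λ_n/I_n`. -/
def regProj (n : ℕ) : Chain R V n →ₗ[R] Chain R V n :=
  Finsupp.lsum R fun p => if IsRegular p then Finsupp.lsingle p else 0

/-- The `(a,b)`-cluster component `w ↦ w^{[a,b]}`. -/
def clusterComp (a b : V) (n : ℕ) : Chain R V n →ₗ[R] Chain R V n :=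
  Finsupp.lsum R fun p =>
    if p 0 = a ∧ p (Fin.last n) = b then Finsupp.lsingle p else 0

/-- The `a`-tail component `w ↦ w^{[a,·]}`. -/
def tailComp (a : V) (n : ℕ) : Chain R V n →ₗ[R] Chain R V n :=
  Finsupp.lsum R fun p => if p 0 = a then Finsupp.lsingle p else 0

/-- The `b`-head component `w ↦ w^{[·,b]}`. -/
def headComp (b : V) (n : ℕ) : Chain R V n →ₗ[R] Chain R V n :=
  Finsupp.lsum R fun p => if p (Fin.last n) = b then Finsupp.lsingle p else 0

/-- `Π_n(G)`: the primitive path chain modules. -/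
def piChains (G : SDigraph V) : (n : ℕ) → Submodule R (Chain R V n)
  | 0 => allowedChains R V G 0
  | n + 1 =>
      allowedChains R V G (n + 1) ⊓ (allowedChains R V G n).comap (boundary R V n)

/-- `Ω_n(G)`: the path chain modules (differential taken modulo irregular paths). -/
def omegaChains (G : SDigraph V) : (n : ℕ) → Submodule R (Chain R V n)
  | 0 => allowedChains R V G 0
  | n + 1 =>
      allowedChains R V G (n + 1) ⊓
        (allowedChains R V G n).comap ((regProj R V n).comp (boundary R V n))

/-- Cycles of the primitive path chain complex. -/
def piCycles (G : SDigraph V) : (n : ℕ) → Submodule R (Chain R V n)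
  | 0 => piChains R V G 0
  | n + 1 => piChains R V G (n + 1) ⊓ LinearMap.ker (boundary R V n)

/-- Boundaries of the primitive path chain complex. -/
def piBoundaries (G : SDigraph V) (n : ℕ) : Submodule R (Chain R V n) :=
  (piChains R V G (n + 1)).map (boundary R V n)

/-- Primitive path homology `H_n(Π_*(G))`: the image of the cycles in the
quotient by the boundaries. -/
abbrev piHomology (G : SDigraph V) (n : ℕ) : Type _ :=
  ↥((piCycles R V G n).map (piBoundaries R V G n).mkQ)

/-- Cycles of the path chain complex `Ω_*`. -/
def omegaCycles (G : SDigraph V) : (n : ℕ) → Submodule R (Chain R V n)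
  | 0 => omegaChains R V G 0
  | n + 1 => omegaChains R V G (n + 1) ⊓ LinearMap.ker ((regProj R V n).comp (boundary R V n))

/-- Boundaries of the path chain complex `Ω_*`. -/
def omegaBoundaries (G : SDigraph V) (n : ℕ) : Submodule R (Chain R V n) :=
  (omegaChains R V G (n + 1)).map ((regProj R V n).comp (boundary R V n))

/-- Path homology `H_n(Ω_*(G))`. -/
abbrev omegaHomology (G : SDigraph V) (n : ℕ) : Type _ :=
  ↥((omegaCycles R V G n).map (omegaBoundaries R V G n).mkQ)

/-- The cluster differential `d : Λ_{n+2}^{[a,b]} → Λ_{n+1}^{[a,b]}`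
(alternating deletion of interior vertices only). -/
def clusterBoundary (n : ℕ) : Chain R V (n + 2) →ₗ[R] Chain R V (n + 1) :=
  Finsupp.lsum R fun p => ∑ m : Fin (n + 1),
    ((-1 : R) ^ (m : ℕ)) •
      Finsupp.lsingle (fun i : Fin (n + 2) => p (m.succ.castSucc.succAbove i))

/-- `π^{[a,b]}` in degrees `≥ 2`: delete the two end vertices. -/
def stripEnds (n : ℕ) : Chain R V (n + 2) →ₗ[R] Chain R V n :=
  Finsupp.lsum R fun p => Finsupp.lsingle (fun i : Fin (n + 1) => p i.succ.castSucc)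

/-- The sum-of-coefficients map (augmentation when `n = 0`). -/
def totalCoeff (n : ℕ) : Chain R V n →ₗ[R] R :=
  Finsupp.lsum R fun _ => LinearMap.id

/-- `A_n^{[a,b]}(G)`: allowed `(a,b)`-cluster chains. -/
def allowedCluster (G : SDigraph V) (a b : V) (n : ℕ) : Submodule R (Chain R V n) :=
  allowedChains R V G n ⊓ clusterSet R V a b n

/-- `Θ_n^{[a,b]}(G)`. -/
def thetaChains (G : SDigraph V) (a b : V) : (n : ℕ) → Submodule R (Chain R V n)
  | 0 => ⊥
  | 1 => allowedCluster R V G a b 1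
  | n + 2 =>
      allowedCluster R V G a b (n + 2) ⊓
        (allowedCluster R V G a b (n + 1)).comap (clusterBoundary R V n)

def thetaCycles (G : SDigraph V) (a b : V) : (n : ℕ) → Submodule R (Chain R V n)
  | 0 => ⊥
  | 1 => thetaChains R V G a b 1
  | n + 2 => thetaChains R V G a b (n + 2) ⊓ LinearMap.ker (clusterBoundary R V n)

def thetaBoundaries (G : SDigraph V) (a b : V) : (n : ℕ) → Submodule R (Chain R V n)
  | 0 => ⊥
  | n + 1 => (thetaChains R V G a b (n + 2)).map (clusterBoundary R V n)

/-- Primitive `(a,b)`-cluster homology `H_n^{[a,b]}(G)`. -/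
abbrev thetaHomology (G : SDigraph V) (a b : V) (n : ℕ) : Type _ :=
  ↥((thetaCycles R V G a b n).map (thetaBoundaries R V G a b n).mkQ)

/-- The tail differential `d^t` (never deleting the tail vertex). -/
def tailBoundary (n : ℕ) : Chain R V (n + 1) →ₗ[R] Chain R V n :=
  Finsupp.lsum R fun p => ∑ m : Fin (n + 1),
    ((-1 : R) ^ (m : ℕ)) • Finsupp.lsingle (fun i : Fin (n + 1) => p (m.succ.succAbove i))

/-- The head differential `d^h` (never deleting the head vertex). -/
def headBoundary (n : ℕ) : Chain R V (n + 1) →ₗ[R] Chain R V n :=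
  Finsupp.lsum R fun p => ∑ m : Fin (n + 1),
    ((-1 : R) ^ (m : ℕ)) • Finsupp.lsingle (fun i : Fin (n + 1) => p (m.castSucc.succAbove i))

/-- `π^{[a,·]}` in degrees `≥ 1`: delete the first vertex. -/
def stripHead (n : ℕ) : Chain R V (n + 1) →ₗ[R] Chain R V n :=
  Finsupp.lsum R fun p => Finsupp.lsingle (fun i : Fin (n + 1) => p i.succ)

/-- `π^{[·,a]}` in degrees `≥ 1`: delete the last vertex. -/
def stripLast (n : ℕ) : Chain R V (n + 1) →ₗ[R] Chain R V n :=
  Finsupp.lsum R fun p => Finsupp.lsingle (fun i : Fin (n + 1) => p i.castSucc)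

/-- `A_n^{[a,·]}(G)`: allowed chains with tail `a`. -/
def allowedTail (G : SDigraph V) (a : V) (n : ℕ) : Submodule R (Chain R V n) :=
  allowedChains R V G n ⊓ tailSet R V a n

/-- `A_n^{[·,a]}(G)`: allowed chains with head `a`. -/
def allowedHead (G : SDigraph V) (a : V) (n : ℕ) : Submodule R (Chain R V n) :=
  allowedChains R V G n ⊓ headSet R V a n

/-- `Θ_n^{[a,·]}(G)`. -/
def tailTheta (G : SDigraph V) (a : V) : (n : ℕ) → Submodule R (Chain R V n)
  | 0 => allowedTail R V G a 0
  | n + 1 =>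
      allowedTail R V G a (n + 1) ⊓ (allowedTail R V G a n).comap (tailBoundary R V n)

/-- `Θ_n^{[·,a]}(G)`. -/
def headTheta (G : SDigraph V) (a : V) : (n : ℕ) → Submodule R (Chain R V n)
  | 0 => allowedHead R V G a 0
  | n + 1 =>
      allowedHead R V G a (n + 1) ⊓ (allowedHead R V G a n).comap (headBoundary R V n)

def tailCycles (G : SDigraph V) (a : V) : (n : ℕ) → Submodule R (Chain R V n)
  | 0 => tailTheta R V G a 0
  | n + 1 => tailTheta R V G a (n + 1) ⊓ LinearMap.ker (tailBoundary R V n)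

def tailBoundaries (G : SDigraph V) (a : V) (n : ℕ) : Submodule R (Chain R V n) :=
  (tailTheta R V G a (n + 1)).map (tailBoundary R V n)

/-- Primitive `a`-tail homology `H_n^{[a,·]}(G)`. -/
abbrev tailHomology (G : SDigraph V) (a : V) (n : ℕ) : Type _ :=
  ↥((tailCycles R V G a n).map (tailBoundaries R V G a n).mkQ)

/-- The path-reversal map with sign `(-1)^{n(n+1)/2}`. -/
def revMap (n : ℕ) : Chain R V n →ₗ[R] Chain R V n :=
  Finsupp.lsum R fun p =>
    ((-1 : R) ^ (n * (n + 1) / 2)) • Finsupp.lsingle (fun i : Fin (n + 1) => p i.rev)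

end

/-- The inverse directed digraph: all arrows reversed. -/
def SDigraph.reverse {V : Type} (G : SDigraph V) : SDigraph V where
  Adj v w := G.Adj w v
  loopless v h := G.loopless v h

section

variable (R : Type) [CommRing R] (V W : Type) [DecidableEq V] [DecidableEq W]

/-- The chain map `f_♯` induced by a vertex map: elementary paths go to their image
when regular, and to `0` otherwise. -/
def chainMap (f : V → W) (n : ℕ) : Chain R V n →ₗ[R] Chain R W n :=
  Finsupp.lsum R fun p =>
    if IsRegular (fun i => f (p i)) then Finsupp.lsingle (fun i => f (p i)) else 0

end

/-- A digraph is asymmetric if it has no symmetric pair of arrows. -/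
def SDigraph.Asymmetric {V : Type} (G : SDigraph V) : Prop :=
  ∀ v w, G.Adj v w → ¬ G.Adj w v


section Helpers

set_option linter.unusedSectionVars false

variable {R V : Type} [CommRing R] [DecidableEq V]

open Classical in
/-- Restriction of a chain to the elementary paths satisfying `P`. -/
def proj {n : ℕ} (P : (Fin (n + 1) → V) → Prop) : Chain R V n →ₗ[R] Chain R V n where
  toFun w := w.filter P
  map_add' _ _ := Finsupp.filter_add
  map_smul' _ _ := Finsupp.filter_smul

open Classical in
lemma proj_apply {n : ℕ} (P : (Fin (n + 1) → V) → Prop) (w : Chain R V n)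
    (p : Fin (n + 1) → V) : proj P w p = if P p then w p else 0 :=
  Finsupp.filter_apply P w p

open Classical in
lemma proj_single {n : ℕ} (P : (Fin (n + 1) → V) → Prop) (p : Fin (n + 1) → V) (r : R) :
    proj P (Finsupp.single p r) = if P p then Finsupp.single p r else 0 := by
  split_ifs with h
  · exact Finsupp.filter_single_of_pos P h
  · exact Finsupp.filter_single_of_neg P h

lemma mem_pathsWith {n : ℕ} {P : (Fin (n + 1) → V) → Prop} {w : Chain R V n} :
    w ∈ pathsWith R V P ↔ ∀ p, w p ≠ 0 → P p := by
  constructor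
  · intro h p hp
    exact h p (Finsupp.mem_support_iff.2 hp)
  · intro h p hp
    exact h p (Finsupp.mem_support_iff.1 hp)

lemma proj_mem_pathsWith {n : ℕ} (P : (Fin (n + 1) → V) → Prop) (w : Chain R V n) :
    proj P w ∈ pathsWith R V P := by
  classical
  rw [mem_pathsWith]
  intro p hp
  rw [proj_apply] at hp
  by_contra h
  simp [h] at hp

lemma proj_mem_of_mem {n : ℕ} (P Q : (Fin (n + 1) → V) → Prop) {w : Chain R V n}
    (hw : w ∈ pathsWith R V Q) : proj P w ∈ pathsWith R V Q := by
  classical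
  rw [mem_pathsWith] at *
  intro p hp
  rw [proj_apply] at hp
  apply hw
  intro h
  simp [h] at hp

lemma boundary_single (n : ℕ) (p : Fin (n + 2) → V) (r : R) :
    boundary R V n (Finsupp.single p r) = ∑ m : Fin (n + 2),
      ((-1 : R) ^ (m : ℕ)) • Finsupp.single (fun i : Fin (n + 1) => p (m.succAbove i)) r := by
  simp [boundary]

lemma faceMap_single (n : ℕ) (m : Fin (n + 2)) (p : Fin (n + 2) → V) (r : R) :
    faceMap R V n m (Finsupp.single p r) =
      Finsupp.single (fun i : Fin (n + 1) => p (m.succAbove i)) r := by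
  simp [faceMap]

lemma boundary_proj (n : ℕ) (m₀ : Fin (n + 2)) (P : (Fin (n + 2) → V) → Prop)
    (Q : (Fin (n + 1) → V) → Prop)
    (h : ∀ m, m ≠ m₀ → ∀ p, Q (fun i => p (m.succAbove i)) ↔ P p) (w : Chain R V (n + 1)) :
    boundary R V n (proj P w) = ((-1 : R) ^ (m₀ : ℕ)) • faceMap R V n m₀ (proj P w) +
      proj Q (boundary R V n w - ((-1 : R) ^ (m₀ : ℕ)) • faceMap R V n m₀ w) := by
  classical
  induction w using Finsupp.induction_linear with
  | zero => simp
  | add x y hx hy =>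
    simp only [map_add, hx, hy, map_sub, smul_add]
    abel
  | single p r =>
    have key : boundary R V n (Finsupp.single p r) -
        ((-1 : R) ^ (m₀ : ℕ)) • faceMap R V n m₀ (Finsupp.single p r) =
        ∑ m ∈ Finset.univ.erase m₀,
      ((-1 : R) ^ (m : ℕ)) • Finsupp.single (fun i : Fin (n + 1) => p (m.succAbove i)) r := by
      rw [boundary_single, faceMap_single, ← Finset.add_sum_erase _ _ (Finset.mem_univ m₀)]
      abel
    have key2 : proj Q (boundary R V n (Finsupp.single p r) -
        ((-1 : R) ^ (m₀ : ℕ)) • faceMap R V n m₀ (Finsupp.single p r)) =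
        if P p then boundary R V n (Finsupp.single p r) -
        ((-1 : R) ^ (m₀ : ℕ)) • faceMap R V n m₀ (Finsupp.single p r) else 0 := by
      rw [key, map_sum]
      split_ifs with hp
      · refine Finset.sum_congr rfl fun m hm => ?_
        rw [map_smul, proj_single, if_pos ((h m (Finset.ne_of_mem_erase hm) p).2 hp)]
      · refine Finset.sum_eq_zero fun m hm => ?_
        rw [map_smul, proj_single,
          if_neg (fun hq => hp ((h m (Finset.ne_of_mem_erase hm) p).1 hq)), smul_zero]
    rw [key2, proj_single]
    split_ifs with hp
    · abel
    · simp

lemma faceMap_mem (G : SDigraph V) (n : ℕ) (m₀ : Fin (n + 2))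
    (h : ∀ p : Fin (n + 2) → V, IsAllowed G p → IsAllowed G (fun i => p (m₀.succAbove i)))
    {w : Chain R V (n + 1)} (hw : w ∈ allowedChains R V G (n + 1)) :
    faceMap R V n m₀ w ∈ allowedChains R V G n := by
  classical
  rw [← Finsupp.sum_single w, Finsupp.sum, map_sum]
  refine Submodule.sum_mem _ fun p hp => ?_
  rw [faceMap_single]
  refine mem_pathsWith.2 fun q hq => ?_
  rw [Finsupp.single_apply] at hq
  split_ifs at hq with e
  · exact e ▸ h p (hw p hp)
  · exact absurd rfl hq

lemma proj_mem_pi_succ (G : SDigraph V) (n : ℕ) (m₀ : Fin (n + 2))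
    (P : (Fin (n + 2) → V) → Prop) (Q : (Fin (n + 1) → V) → Prop)
    (hf : ∀ p : Fin (n + 2) → V, IsAllowed G p → IsAllowed G (fun i => p (m₀.succAbove i)))
    (h : ∀ m, m ≠ m₀ → ∀ p, Q (fun i => p (m.succAbove i)) ↔ P p) {w : Chain R V (n + 1)}
    (hw : w ∈ piChains R V G (n + 1)) : proj P w ∈ piChains R V G (n + 1) := by
  obtain ⟨h1, h2⟩ := hw
  have h3 : proj P w ∈ allowedChains R V G (n + 1) := proj_mem_of_mem _ _ h1
  refine ⟨h3, ?_⟩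
  change boundary R V n (proj P w) ∈ allowedChains R V G n
  rw [boundary_proj n m₀ P Q h]
  refine Submodule.add_mem _ (Submodule.smul_mem _ _ (faceMap_mem G n m₀ hf h3)) ?_
  exact proj_mem_of_mem _ _
    (Submodule.sub_mem _ h2 (Submodule.smul_mem _ _ (faceMap_mem G n m₀ hf h1)))

lemma proj_tail_mem (G : SDigraph V) (n : ℕ) (a : V) {w : Chain R V n}
    (hw : w ∈ piChains R V G n) : proj (fun p => p 0 = a) w ∈ piChains R V G n := by
  cases n with
  | zero => exact proj_mem_of_mem _ _ hw
  | succ n =>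
    refine proj_mem_pi_succ G n 0 _ (fun p => p 0 = a) ?_ ?_ hw
    · intro p hp i
      simpa using hp i.succ
    · intro m hm p
      simp [Fin.succAbove_ne_zero_zero hm]

lemma proj_head_mem (G : SDigraph V) (n : ℕ) (b : V) {w : Chain R V n}
    (hw : w ∈ piChains R V G n) : proj (fun p => p (Fin.last n) = b) w ∈ piChains R V G n := by
  cases n with
  | zero => exact proj_mem_of_mem _ _ hw
  | succ n =>
    refine proj_mem_pi_succ G n (Fin.last _) _ (fun p => p (Fin.last n) = b) ?_ ?_ hw
    · intro p hp i
      simpa using hp i.castSucc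
    · intro m hm p
      simp [Fin.succAbove_ne_last_last hm]

lemma internal_of_proj {ι : Type} [DecidableEq ι] [Fintype ι] {n : ℕ}
    (N : Submodule R (Chain R V n)) (P : ι → (Fin (n + 1) → V) → Prop)
    (f : (Fin (n + 1) → V) → ι) (hP : ∀ i p, P i p ↔ f p = i)
    (hN : ∀ i, ∀ w ∈ N, proj (P i) w ∈ N) :
    DirectSum.IsInternal (fun i : ι => (pathsWith R V (P i) ⊓ N).comap N.subtype) := by
  classical
  set A : ι → Submodule R N := fun i => (pathsWith R V (P i) ⊓ N).comap N.subtype with hA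
  have key : ∀ (x : DirectSum ι fun i => A i) (i : ι),
      proj (P i) ((DirectSum.coeAddMonoidHom A x : N) : Chain R V n) = ((x i : N) : Chain R V n) := by
    intro x i
    induction x using DirectSum.induction_on with
    | zero => simp
    | add x y hx hy => simp only [map_add, Submodule.coe_add, hx, hy, DirectSum.add_apply]
    | of j y =>
      have hy : ((y : N) : Chain R V n) ∈ pathsWith R V (P j) := y.2.1
      rw [DirectSum.coeAddMonoidHom_of]
      by_cases hij : j = i
      · subst hij
        rw [DirectSum.of_eq_same]
        ext p
        rw [proj_apply]
        split_ifs with hp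
        · rfl
        · by_contra hne
          exact hp (mem_pathsWith.1 hy p (Ne.symm hne))
      · rw [DirectSum.of_eq_of_ne _ _ _ (Ne.symm hij)]
        ext p
        rw [proj_apply]
        split_ifs with hp
        · by_contra hne
          exact hij (((hP _ _).1 (mem_pathsWith.1 hy p hne)).symm.trans ((hP _ _).1 hp))
        · rfl
  constructor
  · intro x y hxy
    refine DFinsupp.ext fun i => ?_
    refine Subtype.ext (Subtype.ext ?_)
    exact (key x i).symm.trans ((congrArg (fun z : N => proj (P i) (z : Chain R V n)) hxy).trans
      (key y i))
  · intro y
    refine ⟨∑ i, DirectSum.of (fun i => A i) i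
      ⟨⟨proj (P i) y, hN i _ y.2⟩, ⟨proj_mem_pathsWith _ _, hN i _ y.2⟩⟩, ?_⟩
    rw [map_sum]
    simp only [DirectSum.coeAddMonoidHom_of]
    refine Subtype.ext ?_
    rw [Submodule.coe_sum]
    ext p
    simp [Finsupp.finsetSum_apply, proj_apply, hP]

end Helpers

/-- Corollary 4.4, Proposition 4.7: `Π_n(G)` decomposes as the
internal direct sum of its tail-fixed submodules, of its head-fixed submodules, and of
its cluster submodules; moreover `Π_n^{[a,b]} = Π_n^{[a,·]} ⊓ Π_n^{[·,b]}`. -/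
theorem pi_direct_sum_decompositions
    (R : Type) [CommRing R] (V : Type) [DecidableEq V] [Fintype V]
    (G : SDigraph V) (n : ℕ) :
    DirectSum.IsInternal (fun a : V =>
      (tailSet R V a n ⊓ piChains R V G n).comap (piChains R V G n).subtype) ∧
    DirectSum.IsInternal (fun b : V =>
      (headSet R V b n ⊓ piChains R V G n).comap (piChains R V G n).subtype) ∧
    DirectSum.IsInternal (fun ab : V × V =>
      (clusterSet R V ab.1 ab.2 n ⊓ piChains R V G n).comap
        (piChains R V G n).subtype) ∧
    (∀ a b : V,
      clusterSet R V a b n ⊓ piChains R V G n =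
        (tailSet R V a n ⊓ piChains R V G n) ⊓
          (headSet R V b n ⊓ piChains R V G n)) := by
  refine ⟨?_, ?_, ?_, ?_⟩
  · exact internal_of_proj _ (fun a p => p 0 = a) (fun p => p 0) (fun _ _ => Iff.rfl)
      (fun a w hw => proj_tail_mem G n a hw)
  · exact internal_of_proj _ (fun b p => p (Fin.last n) = b) (fun p => p (Fin.last n))
      (fun _ _ => Iff.rfl) (fun b w hw => proj_head_mem G n b hw)
  · refine internal_of_proj _ (fun (ab : V × V) p => p 0 = ab.1 ∧ p (Fin.last n) = ab.2)
      (fun p => (p 0, p (Fin.last n))) (fun ab p => (Prod.ext_iff (x := (p 0, p (Fin.last n))) (y := ab)).symm) (fun ab w hw => ?_)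
    have := proj_head_mem G n ab.2 (proj_tail_mem G n ab.1 hw)
    convert this using 1
    ext p
    simp only [proj_apply]
    split_ifs <;> tauto
  · intro a b
    ext w
    simp only [Submodule.mem_inf, clusterSet, tailSet, headSet, mem_pathsWith]
    constructor
    · rintro ⟨h, hw⟩
      exact ⟨⟨fun p hp => (h p hp).1, hw⟩, ⟨fun p hp => (h p hp).2, hw⟩⟩
    · rintro ⟨⟨h1, hw⟩, ⟨h2, -⟩⟩
      exact ⟨fun p hp => ⟨h1 p hp, h2 p hp⟩, hw⟩

end PrimitivePath

end
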